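/- arXiv:math/0507485 — 2 statements merged into one kernel-verified Lean document; each statement's English description precedes it below -/
import Mathlib

section
/- Let u ≤ w in the composition poset ℙ*. Then the Möbius function of ℙ* satisfies μ(u,w) = Σ_η (−1)^{d(η)}, where the sum ranges over all normal embeddings η of u into w. -/
/-!
The composition poset ℙ* and its Möbius function (Sagan–Vatter, Theorem 2
"mobius-main").
-/

/-- The underlying word of a composition, as a list of natural numbers. -/
def coes (w : List ℕ+) : List ℕ := w.map (fun x => (x : ℕ))

/-- The order on the composition poset ℙ*: `u ≤ w` iff `w` has a subsequence of
length `|u|` dominating `u` entrywise. -/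
def CompLE (u w : List ℕ+) : Prop := List.SublistForall₂ (· ≤ ·) u w

/-- `η` is an embedding of the composition `u` into the word `W` over ℕ:
it has length `|W|`, its nonzero entries read left to right form `u`, and
`η(i) ≤ W(i)` for all `i`. -/
def IsEmb (u : List ℕ+) (W η : List ℕ) : Prop :=
  η.length = W.length ∧
  η.filter (fun x => decide (x ≠ 0)) = coes u ∧
  ∀ i, η.getD i 0 ≤ W.getD i 0

/-- `[r,t]` is a run of `k`'s in the word `W`: a maximal interval of indices
on which `W` is constantly `k`. -/
def IsRun (W : List ℕ) (k r t : ℕ) : Prop :=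
  r ≤ t ∧ t < W.length ∧ (∀ i, r ≤ i → i ≤ t → W.getD i 0 = k) ∧
  (r = 0 ∨ W.getD (r - 1) 0 ≠ k) ∧ (t + 1 = W.length ∨ W.getD (t + 1) 0 ≠ k)

/-- A normal embedding of `u` into the word `W`: an embedding such that
(1) each `η(i)` is `W(i)`, `W(i) - 1`, or `0`, and (2) for every run `[r,t]`
of `k`'s in `W`, `(r,t] ⊆ Supp η` if `k = 1`, and `r ∈ Supp η` if `k ≥ 2`. -/
def NormalEmb (u : List ℕ+) (W η : List ℕ) : Prop :=
  IsEmb u W η ∧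
  (∀ i, i < W.length →
    η.getD i 0 = W.getD i 0 ∨ η.getD i 0 = W.getD i 0 - 1 ∨ η.getD i 0 = 0) ∧
  ∀ k r t, IsRun W k r t →
    (k = 1 → ∀ i, r < i → i ≤ t → η.getD i 0 ≠ 0) ∧
    (2 ≤ k → η.getD r 0 ≠ 0)

/-- The defect of an embedding `η` into `W`: the number of positions `i` with
`η(i) = W(i) - 1`. -/
def defect (W η : List ℕ) : ℕ :=
  (List.range W.length).countP (fun i => decide (η.getD i 0 = W.getD i 0 - 1))

/-! ### Embedding words greedily -/

/-- The part of `s` that remains to be embedded once the letter `a` has been read greedily. -/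
def greedyStep (a : ℕ) : List ℕ → List ℕ
  | [] => []
  | h :: t => if h ≤ a then t else h :: t

lemma sublistForall₂_of_cons {h : ℕ} {t η : List ℕ}
    (H : List.SublistForall₂ (· ≤ ·) (h :: t) η) : List.SublistForall₂ (· ≤ ·) t η := by
  induction η with
  | nil => cases H
  | cons a η ih =>
    cases H with
    | cons _ h2 => exact .cons_right h2
    | cons_right h2 => exact .cons_right (ih h2)

lemma sublistForall₂_cons_right_iff (s : List ℕ) (a : ℕ) (η : List ℕ) :
    List.SublistForall₂ (· ≤ ·) s (a :: η) ↔
      List.SublistForall₂ (· ≤ ·) (greedyStep a s) η := by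
  cases s with
  | nil => exact ⟨fun _ => .nil, fun _ => .nil⟩
  | cons h t =>
    simp only [greedyStep]
    split_ifs with hle
    · refine ⟨fun H => ?_, fun H => .cons hle H⟩
      cases H with
      | cons _ h2 => exact h2
      | cons_right h2 => exact sublistForall₂_of_cons h2
    · refine ⟨fun H => ?_, fun H => .cons_right H⟩
      cases H with
      | cons h1 _ => exact absurd h1 hle
      | cons_right h2 => exact h2

/-! ### Normal words -/

/-- The letters a normal embedding may use at a position with letter `k` preceded by `p`. -/
def normalLetters (p k : ℕ) : Finset ℕ :=
  if k = p then (if k = 1 then {1} else {k, k - 1, 0}) else {k, k - 1}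

/-- The words underlying normal embeddings into `W`, when `W` is preceded by the letter `p`. -/
def normalWords : ℕ → List ℕ → Finset (List ℕ)
  | _, [] => {[]}
  | p, k :: W => (normalLetters p k ×ˢ normalWords k W).image fun x => x.1 :: x.2

lemma mem_normalWords (p : ℕ) (W η : List ℕ) :
    η ∈ normalWords p W ↔ η.length = W.length ∧
      ∀ i < W.length, η.getD i 0 ∈ normalLetters ((p :: W).getD i 0) (W.getD i 0) := by
  induction W generalizing p η with
  | nil => simp [normalWords]
  | cons k W ih =>
    cases η with
    | nil => simp [normalWords]
    | cons a η =>
      have hmem : a :: η ∈ normalWords p (k :: W) ↔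
          a ∈ normalLetters p k ∧ η ∈ normalWords k W := by
        simp [normalWords]
      rw [hmem, ih]
      constructor
      · rintro ⟨h1, h2, h3⟩
        refine ⟨by simp [h2], fun i hi => ?_⟩
        cases i with
        | zero => simpa using h1
        | succ i => simpa using h3 i (by simpa using hi)
      · rintro ⟨h1, h2⟩
        refine ⟨by simpa using h2 0 (by simp), by simpa using h1, fun i hi => ?_⟩
        simpa using h2 (i + 1) (by simpa using hi)

lemma exists_isRun (W : List ℕ) (i : ℕ) (hi : i < W.length) :
    ∃ r t, r ≤ i ∧ i ≤ t ∧ IsRun W (W.getD i 0) r t := by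
  classical
  have hl : ∃ r, r ≤ i ∧ ∀ j, r ≤ j → j ≤ i → W.getD j 0 = W.getD i 0 :=
    ⟨i, le_rfl, fun j h1 h2 => by rw [le_antisymm h2 h1]⟩
  have hr : ∃ t, i ≤ t ∧ (t + 1 = W.length ∨ W.getD (t + 1) 0 ≠ W.getD i 0) :=
    ⟨W.length - 1, by omega, Or.inl (by omega)⟩
  obtain ⟨hr1, hr2⟩ := Nat.find_spec hl
  obtain ⟨ht1, ht2⟩ := Nat.find_spec hr
  have hconst : ∀ j, i ≤ j → j ≤ Nat.find hr → j < W.length ∧ W.getD j 0 = W.getD i 0 := by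
    intro j hj
    induction j, hj using Nat.le_induction with
    | base => exact fun _ => ⟨hi, rfl⟩
    | succ j hj ih =>
      intro hjt
      have h1 := Nat.find_min hr (m := j) (by omega)
      push Not at h1
      have h2 := h1 hj
      have h3 := ih (by omega)
      exact ⟨by omega, h2.2⟩
  refine ⟨Nat.find hl, Nat.find hr, hr1, ht1, by omega, (hconst _ ht1 le_rfl).1,
    fun j h1 h2 => ?_, ?_, ht2⟩
  · rcases le_total j i with h | h
    · exact hr2 j h1 h
    · exact (hconst j h h2).2
  · by_contra! hcon
    refine Nat.find_min hl (m := Nat.find hl - 1) (by omega) ⟨by omega, fun j h1 h2 => ?_⟩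
    rcases Nat.eq_or_lt_of_le h1 with h | h
    · rw [← h]; exact hcon.2
    · exact hr2 j (by omega) h2

lemma normalEmb_iff (u : List ℕ+) (W η : List ℕ) (hW : ∀ x ∈ W, 0 < x) :
    NormalEmb u W η ↔
      η ∈ normalWords 0 W ∧ η.filter (fun x => decide (x ≠ 0)) = coes u := by
  have hpos : ∀ i < W.length, 0 < W.getD i 0 := fun i hi => by
    rw [List.getD_eq_getElem _ _ hi]; exact hW _ (List.getElem_mem _)
  rw [mem_normalWords]
  constructor
  · rintro ⟨⟨h1, h2, h3⟩, h4, h5⟩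
    refine ⟨⟨h1, fun i hi => ?_⟩, h2⟩
    obtain ⟨r, t, hr, ht, hrun⟩ := exists_isRun W i hi
    have h6 := h5 _ _ _ hrun
    have h4i := h4 i hi
    have hp := hpos i hi
    obtain ⟨-, -, hc, hl, -⟩ := hrun
    unfold normalLetters
    cases i with
    | zero =>
      obtain rfl : r = 0 := by omega
      simp only [List.getD_cons_zero]
      rw [if_neg (by omega)]
      simp only [Finset.mem_insert, Finset.mem_singleton]
      omega
    | succ i =>
      simp only [List.getD_cons_succ]
      split_ifs with ha hb
      · have : r ≠ i + 1 := by
          rintro rfl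
          simp at hl
          exact hl (by simpa using ha.symm)
        have := h6.1 hb (i + 1) (by omega) ht
        simp only [Finset.mem_singleton]
        omega
      · simp only [Finset.mem_insert, Finset.mem_singleton]
        exact h4i
      · have : r = i + 1 := by
          by_contra hne
          exact ha (hc i (by omega) (by omega)).symm
        subst this
        simp only [Finset.mem_insert, Finset.mem_singleton]
        omega
  · rintro ⟨⟨h1, h2⟩, h3⟩
    have hcases : ∀ i < W.length,
        η.getD i 0 = W.getD i 0 ∨ η.getD i 0 = W.getD i 0 - 1 ∨ η.getD i 0 = 0 := by
      intro i hi
      have h := h2 i hi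
      unfold normalLetters at h
      split_ifs at h <;> simp only [Finset.mem_insert, Finset.mem_singleton] at h <;> omega
    refine ⟨⟨h1, h3, fun i => ?_⟩, hcases, ?_⟩
    · rcases lt_or_ge i W.length with hi | hi
      · have := hcases i hi
        omega
      · rw [List.getD_eq_default _ _ (by omega)]
        exact Nat.zero_le _
    · rintro k r t ⟨hrt, ht, hc, hl, -⟩
      constructor
      · rintro rfl i hri hit
        have h := h2 i (by omega)
        obtain ⟨i, rfl⟩ : ∃ j, i = j + 1 := ⟨i - 1, by omega⟩
        rw [List.getD_cons_succ, hc i (by omega) (by omega), hc (i + 1) (by omega) hit] at h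
        simp [normalLetters] at h
        simp [h]
      · intro hk
        have h := h2 r (by omega)
        rw [hc r le_rfl hrt] at h
        have hne : k ≠ (0 :: W).getD r 0 := by
          cases r with
          | zero => simp; omega
          | succ r => simpa [eq_comm] using hl
        rw [normalLetters, if_neg hne] at h
        simp only [Finset.mem_insert, Finset.mem_singleton] at h
        omega

/-! ### The signed sum over normal words -/

lemma defect_cons (k a : ℕ) (W η : List ℕ) :
    defect (k :: W) (a :: η) = (if a = k - 1 then 1 else 0) + defect W η := by
  unfold defect
  rw [List.length_cons, List.range_succ_eq_map, List.countP_cons, List.countP_map, add_comm]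
  congr 1
  · simp

open Classical in
/-- The signed number of normal words for `W` (preceded by `p`) that lie above `s`. -/
noncomputable def signedCount (p : ℕ) (s W : List ℕ) : ℤ :=
  ∑ η ∈ normalWords p W,
    if List.SublistForall₂ (· ≤ ·) s η then (-1) ^ defect W η else 0

lemma signedCount_cons (p k : ℕ) (s W : List ℕ) :
    signedCount p s (k :: W) =
      ∑ a ∈ normalLetters p k,
        (if a = k - 1 then -1 else 1) * signedCount k (greedyStep a s) W := by
  classical
  unfold signedCount
  rw [normalWords, Finset.sum_image (by rintro ⟨a, b⟩ _ ⟨c, d⟩ _ h; simpa using h),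
    Finset.sum_product]
  refine Finset.sum_congr rfl fun a _ => ?_
  rw [Finset.mul_sum]
  refine Finset.sum_congr rfl fun η _ => ?_
  simp only [sublistForall₂_cons_right_iff, defect_cons]
  split_ifs <;> simp [pow_add]

lemma signedCount_cons_of_ne {p k : ℕ} (hk : 0 < k) (hp : k ≠ p) (s W : List ℕ) :
    signedCount p s (k :: W) =
      signedCount k (greedyStep k s) W - signedCount k (greedyStep (k - 1) s) W := by
  rw [signedCount_cons, normalLetters, if_neg hp, Finset.sum_pair (by omega),
    if_neg (by omega), if_pos rfl]
  ring

lemma greedyStep_zero {s : List ℕ} (hs : ∀ x ∈ s, 0 < x) : greedyStep 0 s = s := by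
  cases s with
  | nil => rfl
  | cons h t =>
    have : 0 < h := hs h (by simp)
    exact if_neg (by omega)

lemma signedCount_cons_self {k : ℕ} (hk : 0 < k) {s : List ℕ} (hs : ∀ x ∈ s, 0 < x)
    (W : List ℕ) :
    signedCount k s (k :: W) =
      signedCount k (greedyStep k s) W - signedCount k (greedyStep (k - 1) s) W
        + signedCount k s W := by
  rw [signedCount_cons, normalLetters, if_pos rfl]
  split_ifs with h1
  · subst h1
    simp [greedyStep_zero hs]
  · rw [Finset.sum_insert (by simp; omega), Finset.sum_pair (by omega), if_neg (by omega),
      if_pos rfl, if_neg (by omega), greedyStep_zero hs]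
    ring

lemma greedyStep_pred {k : ℕ} {s : List ℕ} (h : ∀ t, s ≠ k :: t) :
    greedyStep (k - 1) s = greedyStep k s := by
  cases s with
  | nil => rfl
  | cons a t =>
    have : a ≠ k := fun e => h t (by rw [e])
    simp only [greedyStep]
    split_ifs <;> first | rfl | omega

lemma greedyStep_self (k : ℕ) (t : List ℕ) : greedyStep k (k :: t) = t := if_pos le_rfl

lemma greedyStep_pred_self {k : ℕ} (hk : 0 < k) (t : List ℕ) :
    greedyStep (k - 1) (k :: t) = k :: t := if_neg (by omega)

lemma replicate_append_cons_self (m k : ℕ) (t : List ℕ) :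
    List.replicate m k ++ k :: t = k :: (List.replicate m k ++ t) := by
  induction m with
  | zero => rfl
  | succ m ih => simp [List.replicate_succ, ih]

open Classical in
lemma signedCount_eq (p : ℕ) (s W : List ℕ) (hs : ∀ x ∈ s, 0 < x) (hW : ∀ x ∈ W, 0 < x) :
    signedCount p s W = if ∃ m, W = List.replicate m p ++ s then 1 else 0 := by
  induction W generalizing p s with
  | nil =>
    cases s with
    | nil => simp [signedCount, normalWords, defect, List.SublistForall₂.nil]
    | cons h t =>
      have : ¬ List.SublistForall₂ (· ≤ ·) (h :: t) ([] : List ℕ) := by rintro ⟨⟩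
      simp [signedCount, normalWords, this]
  | cons k W ih =>
    have hk : 0 < k := hW k (by simp)
    have ih := fun p s hs => ih p s hs fun x hx => hW x (by simp [hx])
    rcases eq_or_ne k p with rfl | hp
    · rw [signedCount_cons_self hk hs]
      by_cases hst : ∃ t, s = k :: t
      · obtain ⟨t, rfl⟩ := hst
        rw [greedyStep_self, greedyStep_pred_self hk, sub_add_cancel,
          ih k t fun x hx => hs x (by simp [hx])]
        simp [replicate_append_cons_self]
      · rw [greedyStep_pred (by simpa using hst), sub_self, zero_add, ih k s hs]
        congr 1
        refine propext ⟨fun ⟨m, hm⟩ => ⟨m + 1, by simp [hm, List.replicate_succ]⟩, ?_⟩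
        rintro ⟨m, hm⟩
        cases m with
        | zero => exact absurd ⟨W, by simpa using hm.symm⟩ hst
        | succ m => exact ⟨m, by simpa [List.replicate_succ] using hm⟩
    · rw [signedCount_cons_of_ne hk hp]
      have hgoal : (∃ m, k :: W = List.replicate m p ++ s) ↔ k :: W = s := by
        refine ⟨?_, fun h => ⟨0, by simpa using h⟩⟩
        rintro ⟨m, hm⟩
        cases m with
        | zero => simpa using hm
        | succ m =>
          rw [List.replicate_succ, List.cons_append, List.cons.injEq] at hm
          exact absurd hm.1 hp
      rw [if_congr hgoal rfl rfl]
      by_cases hst : ∃ t, s = k :: t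
      · obtain ⟨t, rfl⟩ := hst
        rw [greedyStep_self, greedyStep_pred_self hk, ih k _ hs,
          ih k t fun x hx => hs x (by simp [hx])]
        by_cases hWt : W = t
        · subst hWt
          rw [if_pos ⟨0, rfl⟩, if_neg, if_pos rfl, sub_zero]
          rintro ⟨m, hm⟩
          have := congrArg List.length hm
          simp at this
          omega
        · have : (∃ m, W = List.replicate m k ++ t) ↔
              ∃ m, W = List.replicate m k ++ k :: t := by
            constructor
            · rintro ⟨m, hm⟩
              cases m with
              | zero => exact absurd (by simpa using hm) hWt
              | succ m =>
                exact ⟨m, by rw [hm, replicate_append_cons_self]; rfl⟩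
            · rintro ⟨m, hm⟩
              exact ⟨m + 1, by rw [hm, replicate_append_cons_self]; rfl⟩
          simp [this, hWt]
      · rw [greedyStep_pred (by simpa using hst), sub_self,
          if_neg fun h => hst ⟨W, h.symm⟩]

/-! ### The composition poset -/

lemma coes_eq_map (w : List ℕ+) : coes w = w.map PNat.val := by
  simp [coes, List.map_eq_flatMap]

lemma coes_cons (k : ℕ+) (w : List ℕ+) : coes (k :: w) = (k : ℕ) :: coes w := by
  simp only [coes_eq_map, List.map_cons]

lemma coes_injective : Function.Injective coes := by
  rw [funext coes_eq_map]
  exact List.map_injective_iff.2 PNat.coe_injective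

lemma pos_of_mem_coes {w : List ℕ+} : ∀ x ∈ coes w, 0 < x := by
  simp [coes_eq_map]

/-- The composition formed by the nonzero letters of a word. -/
def nonzeroPart (η : List ℕ) : List ℕ+ :=
  η.filterMap fun n => if h : 0 < n then some (n.toPNat h) else none

lemma nonzeroPart_cons_zero (η : List ℕ) : nonzeroPart (0 :: η) = nonzeroPart η :=
  List.filterMap_cons_none (by simp)

lemma nonzeroPart_cons_of_pos {a : ℕ} (h : 0 < a) (η : List ℕ) :
    nonzeroPart (a :: η) = a.toPNat h :: nonzeroPart η :=
  List.filterMap_cons_some (by simp [h])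

lemma coes_nonzeroPart (η : List ℕ) :
    coes (nonzeroPart η) = η.filter (fun x => decide (x ≠ 0)) := by
  induction η with
  | nil => rfl
  | cons a η ih =>
    rcases Nat.eq_zero_or_pos a with rfl | h
    · rw [nonzeroPart_cons_zero, ih]
      simp
    · rw [nonzeroPart_cons_of_pos h, coes_cons, ih, List.filter_cons_of_pos (by simp; omega)]
      rfl

lemma sublistForall₂_coes_iff (u v : List ℕ+) :
    List.SublistForall₂ (· ≤ ·) (coes u) (coes v) ↔ CompLE u v := by
  unfold CompLE
  rw [coes_eq_map, coes_eq_map, List.sublistForall₂_map_left_iff, List.sublistForall₂_map_right_iff]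
  simp

lemma sublistForall₂_filter_iff (s η : List ℕ) (hs : ∀ x ∈ s, 0 < x) :
    List.SublistForall₂ (· ≤ ·) s (η.filter (fun x => decide (x ≠ 0))) ↔
      List.SublistForall₂ (· ≤ ·) s η := by
  induction η generalizing s with
  | nil => rfl
  | cons a η ih =>
    rcases Nat.eq_zero_or_pos a with rfl | h
    · rw [sublistForall₂_cons_right_iff, greedyStep_zero hs, ← ih s hs]
      simp
    · have hsub : ∀ x ∈ greedyStep a s, 0 < x := by
        intro x hx
        cases s with
        | nil => exact hs x hx
        | cons b t =>
          rw [greedyStep] at hx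
          split_ifs at hx
          · exact hs x (by simp [hx])
          · exact hs x hx
      rw [List.filter_cons_of_pos (by simp; omega), sublistForall₂_cons_right_iff,
        sublistForall₂_cons_right_iff, ih _ hsub]

lemma compLE_nonzeroPart_iff (u : List ℕ+) (η : List ℕ) :
    CompLE u (nonzeroPart η) ↔ List.SublistForall₂ (· ≤ ·) (coes u) η := by
  rw [← sublistForall₂_coes_iff, coes_nonzeroPart, sublistForall₂_filter_iff _ _ pos_of_mem_coes]

lemma nonzeroPart_compLE {p : ℕ} {w : List ℕ+} {η : List ℕ} (h : η ∈ normalWords p (coes w)) :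
    CompLE (nonzeroPart η) w := by
  induction w generalizing p η with
  | nil =>
    obtain rfl : η = [] := by simpa [normalWords, coes] using h
    exact .nil
  | cons k w ih =>
    rw [coes_cons] at h
    obtain ⟨⟨a, η⟩, hx, rfl⟩ := Finset.mem_image.1 h
    obtain ⟨ha, hη⟩ := Finset.mem_product.1 hx
    have hle : a ≤ (k : ℕ) := by
      have hk := k.pos
      unfold normalLetters at ha
      split_ifs at ha <;> simp only [Finset.mem_insert, Finset.mem_singleton] at ha <;> omega
    rcases Nat.eq_zero_or_pos a with rfl | h0
    · exact .cons_right (by rw [nonzeroPart_cons_zero]; exact ih hη)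
    · rw [nonzeroPart_cons_of_pos h0]
      exact .cons (by exact_mod_cast hle) (ih hη)

lemma finite_setOf_compLE (w : List ℕ+) : {v | CompLE v w}.Finite := by
  induction w with
  | nil =>
    refine (Set.finite_singleton []).subset ?_
    rintro v ⟨⟩
    rfl
  | cons k w ih =>
    refine (ih.union (Set.Finite.image2 List.cons (Set.finite_Iic k) ih)).subset ?_
    intro v hv
    cases hv with
    | nil => exact Or.inl .nil
    | cons h1 h2 => exact Or.inr ⟨_, h1, _, h2, rfl⟩
    | cons_right h => exact Or.inl h

lemma eq_or_sum_lt_of_compLE {u v : List ℕ+} (h : CompLE u v) :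
    u = v ∨ (coes u).sum < (coes v).sum := by
  induction v generalizing u with
  | nil => cases h; exact Or.inl rfl
  | cons b v ih =>
    have hb := b.pos
    cases h with
    | nil => right; simp [coes_eq_map]
    | @cons a _ t _ h1 h2 =>
      have h1' : (a : ℕ) ≤ b := h1
      rcases ih h2 with rfl | h3
      · rcases eq_or_lt_of_le h1 with rfl | h4
        · exact Or.inl rfl
        · right
          have h4' : (a : ℕ) < b := h4
          simpa [coes_cons] using h4'
      · right
        simp only [coes_cons, List.sum_cons] at h3 ⊢
        omega
    | cons_right h2 =>
      right
      rcases ih h2 with rfl | h3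
      · simp [coes_cons]
      · simp only [coes_cons, List.sum_cons] at h3 ⊢
        omega

lemma finsum_normalEmb_eq (v w : List ℕ+) :
    ∑ᶠ η ∈ {η : List ℕ | NormalEmb v (coes w) η}, (-1 : ℤ) ^ defect (coes w) η =
      ∑ η ∈ normalWords 0 (coes w) with nonzeroPart η = v, (-1) ^ defect (coes w) η := by
  rw [← finsum_mem_finset_eq_sum]
  refine finsum_mem_congr (Set.ext fun η => ?_) fun _ _ => rfl
  rw [Set.mem_ofPred_eq, normalEmb_iff _ _ _ pos_of_mem_coes, ← coes_nonzeroPart,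
    coes_injective.eq_iff, Finset.mem_coe, Finset.mem_filter]

lemma finsum_interval_normalEmb (u w : List ℕ+) :
    ∑ᶠ v ∈ {v : List ℕ+ | CompLE u v ∧ CompLE v w},
      ∑ᶠ η ∈ {η : List ℕ | NormalEmb v (coes w) η}, (-1 : ℤ) ^ defect (coes w) η =
      if u = w then 1 else 0 := by
  classical
  have hfin : {v : List ℕ+ | CompLE u v ∧ CompLE v w}.Finite :=
    (finite_setOf_compLE w).subset fun v hv => hv.2
  rw [finsum_mem_eq_finite_toFinset_sum _ hfin]
  simp_rw [finsum_normalEmb_eq]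
  rw [Finset.sum_fiberwise_eq_sum_filter, Finset.sum_filter]
  trans signedCount 0 (coes u) (coes w)
  · unfold signedCount
    refine Finset.sum_congr rfl fun η hη => if_congr ?_ rfl rfl
    simp [nonzeroPart_compLE hη, compLE_nonzeroPart_iff]
  · rw [signedCount_eq _ _ _ pos_of_mem_coes pos_of_mem_coes]
    refine if_congr ⟨?_, fun h => ⟨0, by simp [h]⟩⟩ rfl rfl
    rintro ⟨m, hm⟩
    cases m with
    | zero => exact coes_injective (by simpa using hm.symm)
    | succ m => exact absurd (pos_of_mem_coes (w := w) 0 (by simp [hm])) (lt_irrefl 0)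

lemma compLE_refl (u : List ℕ+) : CompLE u u := by
  induction u with
  | nil => exact .nil
  | cons a u ih => exact .cons le_rfl ih

/-- Sagan–Vatter: for `u ≤ w` in the composition poset ℙ*, the Möbius function
(the unique function satisfying the Möbius recurrence on the locally finite
poset ℙ*) is given by `μ(u,w) = Σ_η (-1)^{d(η)}`, summed over all normal
embeddings `η` of `u` into `w`. -/
theorem mobius_of_composition_poset
    (μ : List ℕ+ → List ℕ+ → ℤ)
    (hμ : ∀ u w : List ℕ+, CompLE u w →
      (∑ᶠ v ∈ {v : List ℕ+ | CompLE u v ∧ CompLE v w}, μ v w) =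
        if u = w then 1 else 0)
    (u w : List ℕ+) (h : CompLE u w) :
    μ u w =
      ∑ᶠ η ∈ {η : List ℕ | NormalEmb u (coes w) η}, (-1 : ℤ) ^ defect (coes w) η := by
  induction hn : (coes w).sum - (coes u).sum using Nat.strong_induction_on generalizing u with
  | _ n ih =>
    have hfin : {v : List ℕ+ | CompLE u v ∧ CompLE v w}.Finite :=
      (finite_setOf_compLE w).subset fun v hv => hv.2
    have key := (hμ u w h).trans (finsum_interval_normalEmb u w).symm
    rw [finsum_mem_eq_finite_toFinset_sum _ hfin, finsum_mem_eq_finite_toFinset_sum _ hfin,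
      ← Finset.add_sum_erase _ _ (hfin.mem_toFinset.2 ⟨compLE_refl u, h⟩),
      ← Finset.add_sum_erase _ _ (hfin.mem_toFinset.2 ⟨compLE_refl u, h⟩)] at key
    refine add_right_cancel (key.trans (congrArg _ (Finset.sum_congr rfl fun v hv => ?_).symm))
    obtain ⟨hne, hv⟩ := Finset.mem_erase.1 hv
    obtain ⟨huv, hvw⟩ := hfin.mem_toFinset.1 hv
    refine ih _ ?_ v hvw rfl
    have h1 := (eq_or_sum_lt_of_compLE huv).resolve_left hne.symm
    have h2 : (coes v).sum ≤ (coes w).sum := by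
      rcases eq_or_sum_lt_of_compLE hvw with rfl | h2
      · exact le_rfl
      · exact h2.le
    omega
end

section
/- In the composition poset ℙ*, w covers u if and only if u is obtained from w by decreasing a single part of w by 1, where decreasing a part equal to 1 means deleting it; that is, either u has the same length as w and agrees with w except in one position i where u(i) = w(i) − 1 ≥ 1, or u is obtained from w by deleting one part equal to 1. -/
/-- `w` covers `u` in ℙ*: `u < w` and there is no `v` with `u < v < w`. -/
def CompCovBy (w u : List ℕ+) : Prop :=
  CompLE u w ∧ u ≠ w ∧ ∀ v : List ℕ+, CompLE u v → CompLE v w → v = u ∨ v = w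

/-- `u` is obtained from `w` by decreasing the (positive) part in position `i`
by `1`, the result staying positive: `u` has the same length as `w`, agrees
with `w` off position `i`, and `u(i) + 1 = w(i)` (so `u(i) = w(i) - 1 ≥ 1`). -/
def DecAt (w u : List ℕ+) (i : ℕ) : Prop :=
  u.length = w.length ∧ i < w.length ∧
  (∀ j, j ≠ i → u[j]? = w[j]?) ∧
  ∃ x y : ℕ+, w[i]? = some x ∧ u[i]? = some y ∧ (y : ℕ) + 1 = (x : ℕ)

/-- `u` is obtained from `w` by deleting the part in position `i`, which
equals `1`. -/
def DelOneAt (w u : List ℕ+) (i : ℕ) : Prop :=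
  i < w.length ∧ w[i]? = some 1 ∧ u = w.eraseIdx i

/-- `LowerStep w u`: the composition `u` arises from `w` by lowering a single part by `1`,
a part equal to `1` being deleted. -/
inductive LowerStep : List ℕ+ → List ℕ+ → Prop
  | dec (a : ℕ+) (l : List ℕ+) : LowerStep ((a + 1) :: l) (a :: l)
  | del (l : List ℕ+) : LowerStep (1 :: l) l
  | cons (a : ℕ+) {l l' : List ℕ+} : LowerStep l l' → LowerStep (a :: l) (a :: l')

/-- The size of a composition: the sum of its parts. -/
def compSize (l : List ℕ+) : ℕ := (l.map PNat.val).sum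

@[simp] theorem compSize_cons (a : ℕ+) (l : List ℕ+) :
    compSize (a :: l) = a + compSize l := by
  simp [compSize]

theorem CompLE.refl (l : List ℕ+) : CompLE l l :=
  (List.Sublist.refl l).sublistForall₂

theorem CompLE.compSize_le {u w : List ℕ+} (h : CompLE u w) : compSize u ≤ compSize w := by
  unfold CompLE at h
  induction h with
  | nil => simp [compSize]
  | cons hab _ ih =>
    have := PNat.coe_le_coe _ _ |>.2 hab
    simp only [compSize_cons]
    omega
  | cons_right _ ih =>
    simp only [compSize_cons]
    omega

theorem LowerStep.compLE {w u : List ℕ+} (h : LowerStep w u) : CompLE u w := by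
  induction h with
  | dec a l => exact .cons (PNat.lt_add_right a 1).le (CompLE.refl l)
  | del l => exact .cons_right (CompLE.refl l)
  | cons a _ ih => exact .cons le_rfl ih

theorem LowerStep.compSize_eq {w u : List ℕ+} (h : LowerStep w u) :
    compSize w = compSize u + 1 := by
  induction h with
  | dec a l => simp only [compSize_cons, PNat.add_coe, PNat.one_coe]; omega
  | del l => simp only [compSize_cons, PNat.one_coe]; omega
  | cons a _ ih => simp only [compSize_cons]; omega

/-- The first part of a nonempty composition can be lowered, staying above the remaining parts. -/
theorem exists_lowerStep_cons (a : ℕ+) (l : List ℕ+) :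
    ∃ v, LowerStep (a :: l) v ∧ CompLE l v := by
  rcases eq_or_ne a 1 with rfl | ha
  · exact ⟨l, .del l, CompLE.refl l⟩
  · obtain ⟨b, rfl⟩ := PNat.exists_eq_succ_of_ne_one ha
    exact ⟨b :: l, .dec b l, .cons_right (CompLE.refl l)⟩

theorem CompLE.trans {u v w : List ℕ+} (huv : CompLE u v) (hvw : CompLE v w) : CompLE u w :=
  _root_.trans (r := List.SublistForall₂ (· ≤ ·)) huv hvw

theorem CompLE.eq_or_exists_lowerStep {u w : List ℕ+} (h : CompLE u w) :
    u = w ∨ ∃ v, LowerStep w v ∧ CompLE u v := by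
  unfold CompLE at h
  induction h with
  | @nil l =>
    cases l with
    | nil => exact .inl rfl
    | cons a l =>
      obtain ⟨v, hv, _⟩ := exists_lowerStep_cons a l
      exact .inr ⟨v, hv, .nil⟩
  | @cons a b l₁ l₂ hab hl ih =>
    rcases hab.eq_or_lt with rfl | hlt
    · rcases ih with rfl | ⟨v, hv, hle⟩
      · exact .inl rfl
      · exact .inr ⟨a :: v, .cons a hv, .cons le_rfl hle⟩
    · obtain ⟨c, rfl⟩ := PNat.exists_eq_succ_of_ne_one (one_le.trans_lt hlt).ne'
      exact .inr ⟨c :: l₂, .dec c l₂, .cons (PNat.lt_add_one_iff.1 hlt) hl⟩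
  | @cons_right a l₁ l₂ hl _ =>
    obtain ⟨v, hv, hle⟩ := exists_lowerStep_cons a l₂
    exact .inr ⟨v, hv, CompLE.trans hl hle⟩

theorem CompLE.compSize_lt {u w : List ℕ+} (h : CompLE u w) (hne : u ≠ w) :
    compSize u < compSize w := by
  obtain ⟨v, hv, hle⟩ := h.eq_or_exists_lowerStep.resolve_left hne
  have := hle.compSize_le
  have := hv.compSize_eq
  omega

theorem compCovBy_iff_lowerStep {w u : List ℕ+} : CompCovBy w u ↔ LowerStep w u := by
  constructor
  · rintro ⟨hle, hne, hmin⟩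
    obtain ⟨v, hv, huv⟩ := hle.eq_or_exists_lowerStep.resolve_left hne
    rcases hmin v huv hv.compLE with rfl | rfl
    · exact hv
    · have := hv.compSize_eq
      omega
  · intro h
    have hsize := h.compSize_eq
    refine ⟨h.compLE, ?_, fun v huv hvw => ?_⟩
    · rintro rfl
      omega
    · by_contra! hne
      have := huv.compSize_lt hne.1.symm
      have := hvw.compSize_lt hne.2
      omega

theorem LowerStep.exists_decAt_or_delOneAt {w u : List ℕ+} (h : LowerStep w u) :
    (∃ i, DecAt w u i) ∨ (∃ i, DelOneAt w u i) := by
  induction h with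
  | dec a l =>
    refine .inl ⟨0, rfl, by simp, fun j hj => ?_, a + 1, a, rfl, rfl, rfl⟩
    obtain ⟨k, rfl⟩ := Nat.exists_eq_succ_of_ne_zero hj
    rfl
  | del l => exact .inr ⟨0, by simp, rfl, rfl⟩
  | cons a _ ih =>
    rcases ih with ⟨i, hlen, hi, hoff, x, y, hx, hy, hxy⟩ | ⟨i, hi, hone, rfl⟩
    · refine .inl ⟨i + 1, by simp [hlen], by simpa using hi, fun j hj => ?_, x, y, hx, hy, hxy⟩
      cases j with
      | zero => rfl
      | succ k => exact hoff k (by omega)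
    · exact .inr ⟨i + 1, by simpa using hi, hone, rfl⟩

theorem DelOneAt.lowerStep {w u : List ℕ+} {i : ℕ} (h : DelOneAt w u i) : LowerStep w u := by
  obtain ⟨hi, hone, rfl⟩ := h
  induction w generalizing i with
  | nil => simp at hi
  | cons a l ih =>
    cases i with
    | zero =>
      obtain rfl : a = 1 := by simpa using hone
      exact .del l
    | succ i => exact .cons a (ih (by simpa using hi) hone)

theorem DecAt.lowerStep {w u : List ℕ+} {i : ℕ} (h : DecAt w u i) : LowerStep w u := by
  obtain ⟨hlen, hi, hoff, x, y, hx, hy, hxy⟩ := h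
  induction w generalizing u i with
  | nil => simp at hi
  | cons a l ih =>
    cases u with
    | nil => simp at hlen
    | cons b l' =>
      cases i with
      | zero =>
        obtain rfl : a = x := by simpa using hx
        obtain rfl : b = y := by simpa using hy
        obtain rfl : b + 1 = a := PNat.eq hxy
        obtain rfl : l' = l := List.ext_getElem? fun j => hoff (j + 1) (by omega)
        exact .dec b l'
      | succ i =>
        obtain rfl : b = a := by simpa using hoff 0 (by omega)
        exact .cons b (ih (by simpa using hlen) (by simpa using hi)
          (fun j hj => hoff (j + 1) (by omega)) hx hy)

/-- In ℙ*, `w` covers `u` iff `u` is obtained from `w` by decreasing a single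
part by `1`, a part equal to `1` being deleted: either `u` has the same length
as `w` and agrees with `w` except in one position `i` where
`u(i) = w(i) - 1 ≥ 1`, or `u` is obtained from `w` by deleting one part equal
to `1`. -/
theorem compCovBy_iff (w u : List ℕ+) :
    CompCovBy w u ↔ (∃ i, DecAt w u i) ∨ (∃ i, DelOneAt w u i) := by
  rw [compCovBy_iff_lowerStep]
  refine ⟨LowerStep.exists_decAt_or_delOneAt, ?_⟩
  rintro (⟨i, hi⟩ | ⟨i, hi⟩)
  · exact hi.lowerStep
  · exact hi.lowerStep
end
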